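/- For r = 7: the set of elements D ∈ ℤ^8 with (D,D) = 0 and (D,K_7) = −2 has exactly 126 elements. Moreover, for each such D, the number of unordered pairs {A, B} of (−1)-classes with A + B = D is exactly 6, and every such pair satisfies (A,B) = 1. -/

import Mathlib

/-- The intersection form on `Pic = ℤ^8` with basis `H = e₀`, `E_1,…,E_7`:
`(H,H) = 1`, `(E_i,E_i) = −1`, all other products of distinct basis vectors `0`. -/
def ip (v w : Fin 8 → ℤ) : ℤ := v 0 * w 0 - ∑ i ∈ Finset.univ.erase 0, v i * w i

/-- The canonical class `K_7 = −3H + E_1 + ⋯ + E_7`. -/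
def K7 : Fin 8 → ℤ := fun i => if i = 0 then -3 else 1

/-- A `(−1)`-class: `(E,E) = −1` and `(E,K_7) = −1`. -/
def isClass (E : Fin 8 → ℤ) : Prop := ip E E = -1 ∧ ip E K7 = -1

/-- The integer vectors of length `n` with entries in `[-5, 5]`, coordinate sum `s` and square sum
`q`, listed by a search that prunes with the Cauchy–Schwarz inequality. -/
def vectorsWithSums : (n : ℕ) → ℤ → ℤ → List (Fin n → ℤ)
  | 0, s, q => if s = 0 ∧ q = 0 then [Fin.elim0] else []
  | n + 1, s, q =>
    if s ^ 2 ≤ (n + 1 : ℕ) * q then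
      [-5, -4, -3, -2, -1, 0, 1, 2, 3, 4, 5].flatMap fun a : ℤ =>
        (vectorsWithSums n (s - a) (q - a ^ 2)).map (Fin.cons a)
    else []

theorem mem_vectorsWithSums {n : ℕ} {s q : ℤ} (hq : q < 36) (v : Fin n → ℤ) :
    v ∈ vectorsWithSums n s q ↔ ∑ i, v i = s ∧ ∑ i, v i ^ 2 = q := by
  induction n generalizing s q with
  | zero =>
    have hv : v = Fin.elim0 := Subsingleton.elim _ _
    rw [vectorsWithSums]
    split_ifs with h
    · simp [hv, h.1, h.2]
    · simp only [List.not_mem_nil, Finset.univ_eq_empty, Finset.sum_empty, false_iff]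
      exact fun h' => h ⟨h'.1.symm, h'.2.symm⟩
  | succ n ih =>
    rw [vectorsWithSums]
    have tail_mem (a : ℤ) (w : Fin n → ℤ) := ih (s := s - a) (q := q - a ^ 2)
      (by nlinarith [sq_nonneg a]) w
    split_ifs with h
    · simp only [List.mem_flatMap, List.mem_map, tail_mem]
      constructor
      · rintro ⟨a, -, w, ⟨h1, h2⟩, rfl⟩
        simp [Fin.sum_univ_succ, h1, h2]
      · rintro ⟨h1, h2⟩
        rw [Fin.sum_univ_succ] at h1 h2
        refine ⟨v 0, ?_, Fin.tail v, ⟨?_, ?_⟩, Fin.cons_self_tail v⟩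
        · have h3 : 0 ≤ ∑ i : Fin n, v i.succ ^ 2 := Finset.sum_nonneg fun i _ => sq_nonneg _
          have h4 : -5 ≤ v 0 := by nlinarith
          have h5 : v 0 ≤ 5 := by nlinarith
          generalize v 0 = a at h4 h5
          interval_cases a <;> simp
        · simp only [Fin.tail]; linarith
        · simp only [Fin.tail]; linarith
    · simp only [List.not_mem_nil, false_iff]
      rintro ⟨rfl, rfl⟩
      refine h ?_
      simpa using sq_sum_le_card_mul_sum_sq (s := Finset.univ) (f := v)

theorem nodup_vectorsWithSums (n : ℕ) (s q : ℤ) : (vectorsWithSums n s q).Nodup := by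
  induction n generalizing s q with
  | zero => rw [vectorsWithSums]; split_ifs <;> simp
  | succ n ih =>
    rw [vectorsWithSums]
    split_ifs
    · refine List.nodup_flatMap.2 ⟨fun a _ => (ih _ _).map (Fin.cons_right_injective _), ?_⟩
      refine List.Nodup.pairwise_of_forall_ne (by decide) fun a _ b _ hab => ?_
      simp only [Function.onFun, List.disjoint_left, List.mem_map]
      rintro _ ⟨v, -, rfl⟩ ⟨w, -, hw⟩
      exact hab (Fin.cons_inj.1 hw).1.symm
    · simp

/-- The vectors `D` with `(D,D) = k`, `(D,K_7) = -l` and degree `(D,H)` in the list `ds`. -/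
def classesOfDegrees (k l : ℤ) (ds : List ℤ) : List (Fin 8 → ℤ) :=
  ds.flatMap fun d => (vectorsWithSums 7 (l - 3 * d) (d ^ 2 - k)).map (Fin.cons d)

theorem nodup_classesOfDegrees (k l : ℤ) {ds : List ℤ} (hds : ds.Nodup) :
    (classesOfDegrees k l ds).Nodup := by
  refine List.nodup_flatMap.2
    ⟨fun d _ => (nodup_vectorsWithSums _ _ _).map (Fin.cons_right_injective _), ?_⟩
  refine hds.pairwise_of_forall_ne fun a _ b _ hab => ?_
  simp only [Function.onFun, List.disjoint_left, List.mem_map]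
  rintro _ ⟨v, -, rfl⟩ ⟨w, -, hw⟩
  exact hab (Fin.cons_inj.1 hw).1.symm

theorem ip_eq (v w : Fin 8 → ℤ) : ip v w = v 0 * w 0 - ∑ i : Fin 7, v i.succ * w i.succ := by
  have h := Finset.add_sum_erase Finset.univ (fun i => v i * w i) (Finset.mem_univ (0 : Fin 8))
  rw [Fin.sum_univ_succ] at h
  rw [ip]
  linarith

theorem ip_K7_eq (v : Fin 8 → ℤ) : ip v K7 = -3 * v 0 - ∑ i : Fin 7, v i.succ := by
  simp [ip_eq, K7, Fin.succ_ne_zero, mul_comm]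

theorem ip_add_add (v w : Fin 8 → ℤ) :
    ip (v + w) (v + w) = ip v v + 2 * ip v w + ip w w := by
  simp only [ip, Pi.add_apply, add_mul, mul_add, Finset.sum_add_distrib, mul_comm (w _) (v _)]
  ring

theorem ip_sub_self (v w : Fin 8 → ℤ) :
    ip (v - w) (v - w) = ip v v - 2 * ip w v + ip w w := by
  simp only [ip, Pi.sub_apply, sub_mul, mul_sub, Finset.sum_sub_distrib, mul_comm (v _) (w _)]
  ring

theorem ip_sub_left (u v w : Fin 8 → ℤ) : ip (u - v) w = ip u w - ip v w := by
  simp only [ip, Pi.sub_apply, sub_mul, Finset.sum_sub_distrib]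
  ring

theorem mem_classesOfDegrees {k l : ℤ} {ds : List ℤ} (hk : ∀ d ∈ ds, d ^ 2 - k < 36)
    (hds : ∀ d : ℤ, (l - 3 * d) ^ 2 ≤ 7 * (d ^ 2 - k) → d ∈ ds) (v : Fin 8 → ℤ) :
    v ∈ classesOfDegrees k l ds ↔ ip v v = k ∧ ip v K7 = -l := by
  rw [ip_eq, ip_K7_eq]
  simp only [classesOfDegrees, List.mem_flatMap, List.mem_map, ← sq]
  constructor
  · rintro ⟨d, hd, w, hw, rfl⟩
    obtain ⟨h1, h2⟩ := (mem_vectorsWithSums (hk d hd) w).1 hw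
    simp only [Fin.cons_zero, Fin.cons_succ, h1, h2]
    constructor <;> ring
  · rintro ⟨h1, h2⟩
    have hs : ∑ i : Fin 7, v i.succ = l - 3 * v 0 := by linarith
    have hq : ∑ i : Fin 7, v i.succ ^ 2 = v 0 ^ 2 - k := by linarith
    have hd : v 0 ∈ ds := by
      apply hds
      rw [← hs, ← hq]
      simpa using sq_sum_le_card_mul_sum_sq (s := Finset.univ) (f := fun i : Fin 7 => v i.succ)
    exact ⟨v 0, hd, Fin.tail v, (mem_vectorsWithSums (hk _ hd) _).2 ⟨hs, hq⟩,
      Fin.cons_self_tail v⟩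

theorem mem_rulings (D : Fin 8 → ℤ) :
    D ∈ classesOfDegrees 0 2 [1, 2, 3, 4, 5] ↔ ip D D = 0 ∧ ip D K7 = -2 := by
  refine mem_classesOfDegrees (by decide) (fun d hd => ?_) D
  have h1 : 1 ≤ d := by nlinarith
  have h2 : d ≤ 5 := by nlinarith
  interval_cases d <;> simp

theorem mem_negOneClasses (E : Fin 8 → ℤ) :
    E ∈ classesOfDegrees (-1) 1 [0, 1, 2, 3] ↔ isClass E := by
  refine mem_classesOfDegrees (by decide) (fun d hd => ?_) E
  have h1 : 0 ≤ d := by nlinarith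
  have h2 : d ≤ 3 := by nlinarith
  interval_cases d <;> simp

theorem length_rulings : (classesOfDegrees 0 2 [1, 2, 3, 4, 5]).length = 126 := by
  decide +kernel

theorem length_orthogonal_negOneClasses :
    ∀ D ∈ classesOfDegrees 0 2 [1, 2, 3, 4, 5],
      ((classesOfDegrees (-1) 1 [0, 1, 2, 3]).filter (ip · D = 0)).length = 12 := by
  simp only [ip_eq, Fin.sum_univ_seven]
  decide +kernel

theorem ip_eq_one_of_add_eq_ruling {A B D : Fin 8 → ℤ} (hD : ip D D = 0) (hA : isClass A)
    (hB : isClass B) (hAB : A + B = D) : ip A B = 1 := by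
  have h := ip_add_add A B
  rw [hAB, hD, hA.1, hB.1] at h
  linarith

theorem isClass_sub_iff {A D : Fin 8 → ℤ} (hD : ip D D = 0) (hDK : ip D K7 = -2)
    (hA : isClass A) : isClass (D - A) ↔ ip A D = 0 := by
  rw [isClass, ip_sub_self, ip_sub_left, hD, hDK, hA.1, hA.2]
  constructor
  · rintro ⟨h, -⟩; linarith
  · intro h; simp [h]

theorem ncard_pairs_of_card {D : Fin 8 → ℤ} (hD : ip D D = 0) {T : Finset (Fin 8 → ℤ)} {n : ℕ}
    (hT : ∀ A, A ∈ T ↔ isClass A ∧ isClass (D - A)) (hcard : T.card = n * 2) :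
    {p : Sym2 (Fin 8 → ℤ) | ∃ A B : Fin 8 → ℤ,
      p = s(A, B) ∧ isClass A ∧ isClass B ∧ A + B = D}.ncard = n := by
  have himage : {p : Sym2 (Fin 8 → ℤ) | ∃ A B : Fin 8 → ℤ,
      p = s(A, B) ∧ isClass A ∧ isClass B ∧ A + B = D} = T.image fun A => s(A, D - A) := by
    ext p
    simp only [Set.mem_ofPred_eq, Finset.coe_image, Set.mem_image, Finset.mem_coe, hT]
    constructor
    · rintro ⟨A, B, rfl, hA, hB, rfl⟩
      exact ⟨A, ⟨hA, by simpa using hB⟩, by simp⟩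
    · rintro ⟨A, ⟨hA, hB⟩, rfl⟩
      exact ⟨A, D - A, rfl, hA, hB, by simp⟩
  rw [himage, Set.ncard_coe_finset]
  have hfiber : ∀ p ∈ T.image fun A => s(A, D - A),
      (T.filter fun A => s(A, D - A) = p).card = 2 := by
    intro p hp
    obtain ⟨A, hA, rfl⟩ := Finset.mem_image.1 hp
    obtain ⟨hA1, hA2⟩ := (hT A).1 hA
    have hne : A ≠ D - A := by
      intro h
      have h1 := ip_eq_one_of_add_eq_ruling hD hA1 hA2 (by simp)
      rw [← h, hA1.1] at h1
      norm_num at h1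
    rw [← Finset.card_pair hne]
    congr 1
    ext B
    simp only [Finset.mem_filter, Finset.mem_insert, Finset.mem_singleton, Sym2.eq_iff]
    constructor
    · rintro ⟨-, ⟨h, -⟩ | ⟨h, -⟩⟩
      exacts [Or.inl h, Or.inr h]
    · rintro (rfl | rfl)
      · simp [hA]
      · simp [hT, hA1, hA2]
  have h := Finset.card_eq_sum_card_image (fun A => s(A, D - A)) T
  rw [Finset.sum_congr rfl hfiber, Finset.sum_const, smul_eq_mul, hcard] at h
  omega

theorem statement17 :
    {D : Fin 8 → ℤ | ip D D = 0 ∧ ip D K7 = -2}.ncard = 126 ∧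
    (∀ D : Fin 8 → ℤ, ip D D = 0 → ip D K7 = -2 →
      {p : Sym2 (Fin 8 → ℤ) | ∃ A B : Fin 8 → ℤ,
        p = s(A, B) ∧ isClass A ∧ isClass B ∧ A + B = D}.ncard = 6 ∧
      (∀ A B : Fin 8 → ℤ, isClass A → isClass B → A + B = D → ip A B = 1)) := by
  refine ⟨?_, fun D hD hDK => ⟨?_, fun A B => ip_eq_one_of_add_eq_ruling hD⟩⟩
  · have h : {D : Fin 8 → ℤ | ip D D = 0 ∧ ip D K7 = -2} =
        (classesOfDegrees 0 2 [1, 2, 3, 4, 5]).toFinset := by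
      ext D
      simp [mem_rulings]
    rw [h, Set.ncard_coe_finset, List.toFinset_card_of_nodup
      (nodup_classesOfDegrees _ _ (by decide)), length_rulings]
  · refine ncard_pairs_of_card hD
      (T := ((classesOfDegrees (-1) 1 [0, 1, 2, 3]).filter (ip · D = 0)).toFinset) (fun A => ?_) ?_
    · simp only [List.mem_toFinset, List.mem_filter, mem_negOneClasses, decide_eq_true_eq]
      exact and_congr_right fun hA => (isClass_sub_iff hD hDK hA).symm
    · rw [List.toFinset_card_of_nodup ((nodup_classesOfDegrees _ _ (by decide)).filter _)]
      exact length_orthogonal_negOneClasses D ((mem_rulings D).2 ⟨hD, hDK⟩)
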